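/- Let Σ be a symmetric positive definite k×k real matrix and Σ̂ a symmetric k×k real matrix. Then for every λ ∈ ℝ^k, |λᵀ(Σ − Σ̂)λ| ≤ ‖I − Σ̂Σ⁻¹‖_op · λᵀΣλ, where ‖·‖_op is the operator norm ‖M‖_op = sup_{‖x‖=1} ‖Mx‖ with respect to the Euclidean norm on ℝ^k and I is the k×k identity matrix. -/

import Mathlib

open Matrix

/-- The operator norm of a `k × k` real matrix, induced by the Euclidean norm
on `ℝ^k`: `‖M‖_op = sup_{‖x‖ = 1} ‖M x‖`. -/
noncomputable def opNorm {k : ℕ} (M : Matrix (Fin k) (Fin k) ℝ) : ℝ :=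
  ‖LinearMap.toContinuousLinearMap (Matrix.toEuclideanLin M)‖

theorem opNorm_neg {k : ℕ} (M : Matrix (Fin k) (Fin k) ℝ) : opNorm (-M) = opNorm M := by
  simp [opNorm]

/-- Every real eigenvalue of a matrix is bounded in absolute value by its operator norm. -/
theorem abs_le_opNorm_of_mulVec_eq_smul {k : ℕ} {M : Matrix (Fin k) (Fin k) ℝ} {μ : ℝ}
    {w : Fin k → ℝ} (hw : w ≠ 0) (h : M *ᵥ w = μ • w) : |μ| ≤ opNorm M := by
  have hle := (LinearMap.toContinuousLinearMap (Matrix.toEuclideanLin M)).le_opNorm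
    (WithLp.toLp 2 w)
  have hMw : LinearMap.toContinuousLinearMap (Matrix.toEuclideanLin M) (WithLp.toLp 2 w)
      = μ • WithLp.toLp 2 w := by
    simp [h]
  rw [hMw, norm_smul, Real.norm_eq_abs] at hle
  exact le_of_mul_le_mul_right hle (norm_pos_iff.2 (by simpa using hw))

open scoped MatrixOrder in
theorem Matrix.PosDef.exists_isUnit_eq_conjTranspose_mul_self {k : ℕ}
    {S : Matrix (Fin k) (Fin k) ℝ} (hS : S.PosDef) :
    ∃ R : Matrix (Fin k) (Fin k) ℝ, IsUnit R ∧ S = Rᴴ * R := by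
  let _ : NormedRing (Matrix (Fin k) (Fin k) ℝ) := Matrix.instL2OpNormedRing
  obtain ⟨R, hR, h⟩ := CStarAlgebra.isStrictlyPositive_iff_eq_star_mul_self.mp
    hS.isStrictlyPositive
  exact ⟨R, hR, h⟩

/-- A symmetric `D` is dominated by `‖D S⁻¹‖ • S` in the Loewner order. -/
theorem posSemidef_opNorm_smul_sub {k : ℕ} {S D : Matrix (Fin k) (Fin k) ℝ}
    (hS : S.PosDef) (hD : D.IsHermitian) :
    (opNorm (D * S⁻¹) • S - D).PosSemidef := by
  obtain ⟨R, hR, hSR⟩ := hS.exists_isUnit_eq_conjTranspose_mul_self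
  set c := opNorm (D * S⁻¹)
  set E := c • S - D with hE
  have hRdet : IsUnit R.det := (isUnit_iff_isUnit_det R).1 hR
  have hSdet : IsUnit S.det := (isUnit_iff_isUnit_det S).1 hS.isUnit
  have hEherm : E.IsHermitian := (hS.1.smul (IsSelfAdjoint.all c)).sub hD
  have hF : (R⁻¹ᴴ * E * R⁻¹).IsHermitian := isHermitian_conjTranspose_mul_mul _ hEherm
  refine (((isUnit_nonsing_inv_iff).2 hR).posSemidef_star_left_conjugate_iff).1
    (hF.posSemidef_iff_eigenvalues_nonneg.2 fun i ↦ ?_)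
  set v : Fin k → ℝ := ⇑(hF.eigenvectorBasis i)
  set l := hF.eigenvalues i
  have hv : (R⁻¹ᴴ * E * R⁻¹) *ᵥ v = l • v := hF.mulVec_eigenvectorBasis i
  have hv0 : v ≠ 0 := by
    intro h
    exact hF.eigenvectorBasis.orthonormal.ne_zero i (by ext j; exact congrFun h j)
  have hRR : Rᴴ * R⁻¹ᴴ = 1 := by
    rw [← conjTranspose_mul, nonsing_inv_mul _ hRdet, conjTranspose_one]
  have hSu : S *ᵥ (R⁻¹ *ᵥ v) = Rᴴ *ᵥ v := by
    rw [mulVec_mulVec, hSR, mul_assoc, mul_nonsing_inv _ hRdet, mul_one]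
  have hEu : E *ᵥ (R⁻¹ *ᵥ v) = l • (Rᴴ *ᵥ v) := by
    rw [← mulVec_smul, ← hv, mulVec_mulVec, mulVec_mulVec, ← mul_assoc, ← mul_assoc, hRR, one_mul]
  have hDu : D *ᵥ (R⁻¹ *ᵥ v) = (c - l) • (Rᴴ *ᵥ v) := by
    rw [sub_smul, ← hEu, hE, sub_mulVec, smul_mulVec, hSu, sub_sub_cancel]
  have hw0 : Rᴴ *ᵥ v ≠ 0 := by
    intro h
    have : R⁻¹ᴴ * Rᴴ = 1 := by
      rw [← conjTranspose_mul, mul_nonsing_inv _ hRdet, conjTranspose_one]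
    apply hv0
    rw [← one_mulVec v, ← this, ← mulVec_mulVec, h, mulVec_zero]
  have hM : (D * S⁻¹) *ᵥ (Rᴴ *ᵥ v) = (c - l) • (Rᴴ *ᵥ v) := by
    rw [← hDu, ← hSu, mulVec_mulVec, mul_assoc, nonsing_inv_mul _ hSdet, mul_one]
  have := le_of_abs_le (abs_le_opNorm_of_mulVec_eq_smul hw0 hM)
  change 0 ≤ l
  linarith

/-- Lemma A.1 of Lavancier–Rochet: for a symmetric positive definite `Σ` and a
symmetric `Σ̂`, for every `λ`, `|λᵀ(Σ - Σ̂)λ| ≤ ‖I - Σ̂ Σ⁻¹‖_op · λᵀ Σ λ`. -/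
theorem quadratic_form_perturbation (k : ℕ)
    (S : Matrix (Fin k) (Fin k) ℝ) (hS : S.PosDef)
    (Shat : Matrix (Fin k) (Fin k) ℝ) (hShat : Shat.IsSymm)
    (lam : Fin k → ℝ) :
    |lam ⬝ᵥ ((S - Shat) *ᵥ lam)| ≤ opNorm (1 - Shat * S⁻¹) * (lam ⬝ᵥ (S *ᵥ lam)) := by
  have hSdet : IsUnit S.det := (isUnit_iff_isUnit_det S).1 hS.isUnit
  have hM : 1 - Shat * S⁻¹ = (S - Shat) * S⁻¹ := by
    rw [sub_mul, mul_nonsing_inv _ hSdet]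
  have hD : (S - Shat).IsHermitian :=
    hS.1.sub (by rwa [IsHermitian, conjTranspose_eq_transpose_of_trivial])
  have h₁ := (posSemidef_opNorm_smul_sub hS hD).dotProduct_mulVec_nonneg lam
  have h₂ := (posSemidef_opNorm_smul_sub hS hD.neg).dotProduct_mulVec_nonneg lam
  rw [neg_mul, opNorm_neg] at h₂
  rw [hM]
  generalize S - Shat = D at h₁ h₂ ⊢
  simp only [star_trivial, sub_mulVec, neg_mulVec, smul_mulVec, dotProduct_sub, dotProduct_neg,
    dotProduct_smul, smul_eq_mul] at h₁ h₂
  exact abs_le.2 ⟨by linarith, by linarith⟩
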